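/- For any probability distributions P, Q, and R on the same finite index set (nonnegative real entries summing to 1), the cube root of DLITE satisfies the triangle inequality: DL(P,Q)^(1/3) + DL(Q,R)^(1/3) ≥ DL(P,R)^(1/3). -/

import Mathlib

open Real Finset

/-- lit(p,q) = |p(1 - log p) - q(1 - log q)|, natural log, with 0*log 0 = 0
(automatic since Real.log 0 = 0). -/
noncomputable def lit (p q : ℝ) : ℝ :=
  |p * (1 - Real.log p) - q * (1 - Real.log q)|

/-- δh(p,q) = |p²(1 - 2 log p) - q²(1 - 2 log q)| / (2(p+q)), with δh(0,0) = 0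
(automatic since division by zero is 0 in Lean). -/
noncomputable def deltaH (p q : ℝ) : ℝ :=
  |p ^ 2 * (1 - 2 * Real.log p) - q ^ 2 * (1 - 2 * Real.log q)| / (2 * (p + q))

/-- dl(p,q) = lit(p,q) - δh(p,q). -/
noncomputable def dl (p q : ℝ) : ℝ := lit p q - deltaH p q

/-- DLITE of two distributions on a finite index set: DL(P,Q) = ∑ i, dl(P i, Q i). -/
noncomputable def DL {ι : Type*} [Fintype ι] (P Q : ι → ℝ) : ℝ :=
  ∑ i, dl (P i) (Q i)

/-- `IsProbDist P` : nonnegative real entries summing to 1. -/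
def IsProbDist {ι : Type*} [Fintype ι] (P : ι → ℝ) : Prop :=
  (∀ i, 0 ≤ P i) ∧ ∑ i, P i = 1

lemma nonneg_of_hasDerivAt_nonneg {f f' : ℝ → ℝ} (hf : ∀ x, HasDerivAt f (f' x) x)
    (hf' : ∀ x, 0 ≤ x → 0 ≤ f' x) (h0 : f 0 = 0) {x : ℝ} (hx : 0 ≤ x) : 0 ≤ f x := by
  have hmono : MonotoneOn f (Set.Ici 0) := by
    refine monotoneOn_of_deriv_nonneg (convex_Ici 0)
      (fun y _ => (hf y).continuousAt.continuousWithinAt)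
      (fun y _ => (hf y).differentiableAt.differentiableWithinAt) fun y hy => ?_
    rw [interior_Ici] at hy
    rw [(hf y).deriv]
    exact hf' y (le_of_lt hy)
  simpa [h0] using hmono Set.self_mem_Ici hx hx

lemma four_mul_cosh_sub_one_le {v : ℝ} (hv : 0 ≤ v) :
    4 * (cosh v - 1) ≤ v * sinh v + v ^ 2 := by
  have h3 : ∀ v : ℝ, 0 ≤ v → 0 ≤ v * cosh v - sinh v := fun v hv =>
    nonneg_of_hasDerivAt_nonneg (f := fun v => v * cosh v - sinh v) (f' := fun v => v * sinh v)
      (fun x => (((hasDerivAt_id' x).mul (hasDerivAt_cosh x)).sub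
        (hasDerivAt_sinh x)).congr_deriv (by ring))
      (fun x hx => mul_nonneg hx (sinh_nonneg_iff.2 hx)) (by simp) hv
  have h2 : ∀ v : ℝ, 0 ≤ v → 0 ≤ v * sinh v + 2 - 2 * cosh v := fun v hv =>
    nonneg_of_hasDerivAt_nonneg (f := fun v => v * sinh v + 2 - 2 * cosh v)
      (fun x => ((((hasDerivAt_id' x).mul (hasDerivAt_sinh x)).add_const 2).sub
        ((hasDerivAt_cosh x).const_mul 2)).congr_deriv (by ring))
      h3 (by simp) hv
  have h1 : ∀ v : ℝ, 0 ≤ v → 0 ≤ v * cosh v + 2 * v - 3 * sinh v := fun v hv =>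
    nonneg_of_hasDerivAt_nonneg (f := fun v => v * cosh v + 2 * v - 3 * sinh v)
      (fun x => ((((hasDerivAt_id' x).mul (hasDerivAt_cosh x)).add
        ((hasDerivAt_id' x).const_mul 2)).sub
        ((hasDerivAt_sinh x).const_mul 3)).congr_deriv (by ring))
      h2 (by simp) hv
  have h0 : 0 ≤ v * sinh v + v ^ 2 - 4 * (cosh v - 1) :=
    nonneg_of_hasDerivAt_nonneg (f := fun v => v * sinh v + v ^ 2 - 4 * (cosh v - 1))
      (fun x => ((((hasDerivAt_id' x).mul (hasDerivAt_sinh x)).add (hasDerivAt_pow 2 x)).sub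
        (((hasDerivAt_cosh x).sub_const 1).const_mul 4)).congr_deriv (by push_cast; ring))
      h1 (by simp) hv
  linarith

lemma four_mul_sub_one_sq_le_log {y : ℝ} (hy : 1 ≤ y) :
    4 * (y - 1) ^ 2 ≤ (y ^ 2 - 1) * log y + 2 * y * log y ^ 2 := by
  have hy0 : 0 < y := by linarith
  have h := four_mul_cosh_sub_one_le (log_nonneg hy)
  rw [cosh_log hy0, sinh_log hy0] at h
  have h' := mul_le_mul_of_nonneg_left h (by positivity : 0 ≤ 2 * y)
  have e1 : 2 * y * (4 * ((y + y⁻¹) / 2 - 1)) = 4 * (y - 1) ^ 2 := by field_simp; ring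
  have e2 : 2 * y * (log y * ((y - y⁻¹) / 2) + log y ^ 2)
      = (y ^ 2 - 1) * log y + 2 * y * log y ^ 2 := by field_simp
  linarith

lemma two_mul_sq_sub_sq_sq_le_log {p q : ℝ} (hp : 0 < p) (hpq : p ≤ q) :
    2 * (q ^ 2 - p ^ 2) ^ 2 ≤ (q ^ 2 - p ^ 2) * (q ^ 2 + p ^ 2) * (log q - log p)
      + 4 * p ^ 2 * q ^ 2 * (log q - log p) ^ 2 := by
  have hq : 0 < q := by linarith
  have hy : 1 ≤ (q / p) ^ 2 := one_le_pow₀ ((one_le_div hp).2 hpq)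
  have h := four_mul_sub_one_sq_le_log hy
  rw [log_pow, log_div hq.ne' hp.ne'] at h
  have h' := mul_le_mul_of_nonneg_left h (by positivity : 0 ≤ p ^ 4 / 2)
  have e1 : p ^ 4 / 2 * (4 * ((q / p) ^ 2 - 1) ^ 2) = 2 * (q ^ 2 - p ^ 2) ^ 2 := by
    field_simp; ring
  have e2 : p ^ 4 / 2 * ((((q / p) ^ 2) ^ 2 - 1) * ((2 : ℕ) * (log q - log p))
      + 2 * (q / p) ^ 2 * ((2 : ℕ) * (log q - log p)) ^ 2)
      = (q ^ 2 - p ^ 2) * (q ^ 2 + p ^ 2) * (log q - log p)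
      + 4 * p ^ 2 * q ^ 2 * (log q - log p) ^ 2 := by
    push_cast; field_simp; ring
  linarith

lemma two_mul_sq_mul_log_sub_log_lt {p q : ℝ} (hp : 0 < p) (hpq : p < q) :
    2 * p ^ 2 * (log q - log p) < q ^ 2 - p ^ 2 := by
  have hq : 0 < q := by linarith
  have hy : 1 < (q / p) ^ 2 := one_lt_pow₀ ((one_lt_div hp).2 hpq) two_ne_zero
  have h := log_lt_sub_one_of_pos (by positivity) hy.ne'
  rw [log_pow, log_div hq.ne' hp.ne', div_pow] at h
  have h' := mul_lt_mul_of_pos_left h (by positivity : 0 < p ^ 2)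
  have e : p ^ 2 * (q ^ 2 / p ^ 2 - 1) = q ^ 2 - p ^ 2 := by field_simp
  push_cast at h'
  linarith

lemma sq_sub_sq_le_two_mul_sq_mul_log_sub_log {p q : ℝ} (hp : 0 < p) (hpq : p ≤ q) :
    q ^ 2 - p ^ 2 ≤ 2 * q ^ 2 * (log q - log p) := by
  have hq : 0 < q := by linarith
  have h := one_sub_inv_le_log_of_pos (by positivity : 0 < (q / p) ^ 2)
  rw [log_pow, log_div hq.ne' hp.ne', div_pow] at h
  have h' := mul_le_mul_of_nonneg_left h (by positivity : 0 ≤ q ^ 2)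
  have e : q ^ 2 * (1 - (q ^ 2 / p ^ 2)⁻¹) = q ^ 2 - p ^ 2 := by field_simp
  push_cast at h'
  linarith

/-- The closed form of `dl p q` when `p ≤ q`. -/
noncomputable def dlOrdered (p q : ℝ) : ℝ := (q - p) / 2 - p * q / (p + q) * (log q - log p)

/-- The partial derivative of `dlOrdered` in its second argument. -/
noncomputable def dlOrderedRight (p q : ℝ) : ℝ :=
  ((q ^ 2 - p ^ 2) / 2 - p ^ 2 * (log q - log p)) / (p + q) ^ 2

/-- The partial derivative of `dlOrdered` in its first argument. -/
noncomputable def dlOrderedLeft (p q : ℝ) : ℝ :=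
  ((q ^ 2 - p ^ 2) / 2 - q ^ 2 * (log q - log p)) / (p + q) ^ 2

/-- The mixed second partial derivative of `dlOrdered`. -/
noncomputable def dlOrderedMixed (p q : ℝ) : ℝ :=
  -(2 * p * q * (log q - log p) + (q ^ 2 - p ^ 2)) / (p + q) ^ 3

lemma hasDerivAt_dlOrdered_right {p q : ℝ} (hp : 0 < p) (hq : 0 < q) :
    HasDerivAt (fun x => dlOrdered p x) (dlOrderedRight p q) q := by
  have hne : p + q ≠ 0 := by positivity
  refine ((((hasDerivAt_id' q).sub_const p).div_const 2).sub
    ((((hasDerivAt_id' q).const_mul p).div ((hasDerivAt_id' q).const_add p) hne).mul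
      ((hasDerivAt_log hq.ne').sub_const (log p)))).congr_deriv ?_
  unfold dlOrderedRight
  simp only [Pi.div_apply]
  field_simp
  ring

lemma hasDerivAt_dlOrdered_left {p q : ℝ} (hp : 0 < p) (hq : 0 < q) :
    HasDerivAt (fun x => dlOrdered x q) (dlOrderedLeft p q) p := by
  have hne : p + q ≠ 0 := by positivity
  refine ((((hasDerivAt_id' p).const_sub q).div_const 2).sub
    ((((hasDerivAt_id' p).mul_const q).div ((hasDerivAt_id' p).add_const q) hne).mul
      ((hasDerivAt_log hp.ne').const_sub (log q)))).congr_deriv ?_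
  unfold dlOrderedLeft
  simp only [Pi.div_apply]
  field_simp
  ring

lemma hasDerivAt_dlOrderedRight_left {p q : ℝ} (hp : 0 < p) (hq : 0 < q) :
    HasDerivAt (fun x => dlOrderedRight x q) (dlOrderedMixed p q) p := by
  have hne : p + q ≠ 0 := by positivity
  refine (((((hasDerivAt_pow 2 p).const_sub (q ^ 2)).div_const 2).sub
    ((hasDerivAt_pow 2 p).mul ((hasDerivAt_log hp.ne').const_sub (log q)))).div
      (((hasDerivAt_id' p).add_const q).pow 2) (pow_ne_zero 2 hne)).congr_deriv ?_
  unfold dlOrderedMixed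
  simp only [Pi.pow_apply, Pi.mul_apply, Pi.sub_apply]
  push_cast
  field_simp
  ring

lemma dlOrderedRight_pos {p q : ℝ} (hp : 0 < p) (hpq : p < q) : 0 < dlOrderedRight p q := by
  have hq : 0 < q := hp.trans hpq
  have := two_mul_sq_mul_log_sub_log_lt hp hpq
  exact div_pos (by linarith) (by positivity)

lemma dlOrderedLeft_nonpos {p q : ℝ} (hp : 0 < p) (hpq : p ≤ q) : dlOrderedLeft p q ≤ 0 := by
  have := sq_sub_sq_le_two_mul_sq_mul_log_sub_log hp hpq
  exact div_nonpos_of_nonpos_of_nonneg (by linarith) (by positivity)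

lemma two_mul_dlOrderedLeft_mul_dlOrderedRight_le {p q : ℝ} (hp : 0 < p) (hpq : p ≤ q) :
    2 * (dlOrderedLeft p q * dlOrderedRight p q) ≤ 3 * (dlOrdered p q * dlOrderedMixed p q) := by
  have hq : 0 < q := by linarith
  have h := two_mul_sq_sub_sq_sq_le_log hp hpq
  rw [← sub_nonneg]
  have e : 3 * (dlOrdered p q * dlOrderedMixed p q)
      - 2 * (dlOrderedLeft p q * dlOrderedRight p q)
      = ((q ^ 2 - p ^ 2) * (q ^ 2 + p ^ 2) * (log q - log p)
        + 4 * p ^ 2 * q ^ 2 * (log q - log p) ^ 2 - 2 * (q ^ 2 - p ^ 2) ^ 2) / (p + q) ^ 4 := by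
    unfold dlOrdered dlOrderedMixed dlOrderedLeft dlOrderedRight
    field_simp
    ring
  rw [e]
  exact div_nonneg (by linarith) (by positivity)

@[simp] lemma dlOrdered_self (p : ℝ) : dlOrdered p p = 0 := by simp [dlOrdered]

lemma dlOrdered_strictMonoOn_right {p : ℝ} (hp : 0 < p) :
    StrictMonoOn (fun x => dlOrdered p x) (Set.Ici p) := by
  refine strictMonoOn_of_deriv_pos (convex_Ici p) (fun y hy =>
    (hasDerivAt_dlOrdered_right hp (hp.trans_le hy)).continuousAt.continuousWithinAt)
    fun y hy => ?_
  rw [interior_Ici, Set.mem_Ioi] at hy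
  rw [(hasDerivAt_dlOrdered_right hp (hp.trans hy)).deriv]
  exact dlOrderedRight_pos hp hy

lemma dlOrdered_antitoneOn_left {q : ℝ} (hq : 0 < q) :
    AntitoneOn (fun x => dlOrdered x q) (Set.Ioc 0 q) := by
  refine antitoneOn_of_deriv_nonpos (convex_Ioc 0 q) (fun y hy =>
    (hasDerivAt_dlOrdered_left hy.1 hq).continuousAt.continuousWithinAt)
    (fun y hy => ?_) fun y hy => ?_ <;> rw [interior_Ioc] at hy
  · exact (hasDerivAt_dlOrdered_left hy.1 hq).differentiableAt.differentiableWithinAt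
  · rw [(hasDerivAt_dlOrdered_left hy.1 hq).deriv]
    exact dlOrderedLeft_nonpos hy.1 hy.2.le

lemma dlOrdered_pos {p q : ℝ} (hp : 0 < p) (hpq : p < q) : 0 < dlOrdered p q := by
  simpa using dlOrdered_strictMonoOn_right hp Set.self_mem_Ici hpq.le hpq

lemma dlOrdered_nonneg {p q : ℝ} (hp : 0 < p) (hpq : p ≤ q) : 0 ≤ dlOrdered p q := by
  rcases hpq.eq_or_lt with rfl | h
  · simp
  · exact (dlOrdered_pos hp h).le

lemma dlOrderedRight_mul_rpow_monotoneOn {r : ℝ} (hr : 0 < r) :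
    MonotoneOn (fun x => dlOrderedRight x r * dlOrdered x r ^ (-(2 / 3) : ℝ)) (Set.Ioo 0 r) := by
  have hd : ∀ y ∈ Set.Ioo 0 r, HasDerivAt
      (fun x => dlOrderedRight x r * dlOrdered x r ^ (-(2 / 3) : ℝ))
      (dlOrderedMixed y r * dlOrdered y r ^ (-(2 / 3) : ℝ) + dlOrderedRight y r *
        (dlOrderedLeft y r * (-(2 / 3)) * dlOrdered y r ^ (-(2 / 3) - 1 : ℝ))) y := fun y hy =>
    (hasDerivAt_dlOrderedRight_left hy.1 hr).mul
      ((hasDerivAt_dlOrdered_left hy.1 hr).rpow_const (Or.inl (dlOrdered_pos hy.1 hy.2).ne'))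
  refine monotoneOn_of_deriv_nonneg (convex_Ioo 0 r)
    (fun y hy => (hd y hy).continuousAt.continuousWithinAt)
    (fun y hy => ?_) fun y hy => ?_ <;> rw [interior_Ioo] at hy
  · exact (hd y hy).differentiableAt.differentiableWithinAt
  · rw [(hd y hy).deriv]
    have hpos := dlOrdered_pos hy.1 hy.2
    have e : dlOrdered y r ^ (-(2 / 3) : ℝ)
        = dlOrdered y r ^ (-(2 / 3) - 1 : ℝ) * dlOrdered y r := by
      rw [← rpow_add_one hpos.ne']
      norm_num
    rw [e]
    have h := two_mul_dlOrderedLeft_mul_dlOrderedRight_le hy.1 hy.2.le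
    have h' : 0 ≤ dlOrdered y r ^ (-(2 / 3) - 1 : ℝ) * (dlOrdered y r * dlOrderedMixed y r
        - 2 / 3 * (dlOrderedLeft y r * dlOrderedRight y r)) :=
      mul_nonneg (rpow_nonneg hpos.le _) (by linarith)
    linarith

lemma dlOrdered_rpow_triangle {p q r : ℝ} (hp : 0 < p) (hpq : p ≤ q) (hqr : q ≤ r) :
    dlOrdered p r ^ ((1 : ℝ) / 3)
      ≤ dlOrdered p q ^ ((1 : ℝ) / 3) + dlOrdered q r ^ ((1 : ℝ) / 3) := by
  have hq : 0 < q := by linarith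
  have hd : ∀ a, 0 < a → ∀ y, a < y → HasDerivAt (fun x => dlOrdered a x ^ ((1 : ℝ) / 3))
      (dlOrderedRight a y * (1 / 3) * dlOrdered a y ^ ((1 : ℝ) / 3 - 1)) y := fun a ha y hy =>
    (hasDerivAt_dlOrdered_right ha (ha.trans hy)).rpow_const (Or.inl (dlOrdered_pos ha hy).ne')
  have hc : ∀ a, 0 < a → ∀ y, 0 < y → ContinuousAt (fun x => dlOrdered a x ^ ((1 : ℝ) / 3)) y :=
    fun a ha y hy => (hasDerivAt_dlOrdered_right ha hy).continuousAt.rpow_const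
      (Or.inr (by norm_num))
  have hanti : AntitoneOn
      (fun x => dlOrdered p x ^ ((1 : ℝ) / 3) - dlOrdered q x ^ ((1 : ℝ) / 3)) (Set.Ici q) := by
    refine antitoneOn_of_deriv_nonpos (convex_Ici q) (fun y hy => ?_)
      (fun y hy => ?_) fun y hy => ?_
    · have hy0 : 0 < y := hq.trans_le hy
      exact ((hc p hp y hy0).sub (hc q hq y hy0)).continuousWithinAt
    all_goals
      rw [interior_Ici, Set.mem_Ioi] at hy
      have hD := (hd p hp y (hpq.trans_lt hy)).sub (hd q hq y hy)
    · exact hD.differentiableAt.differentiableWithinAt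
    · have hM := dlOrderedRight_mul_rpow_monotoneOn (hq.trans hy)
        ⟨hp, hpq.trans_lt hy⟩ ⟨hq, hy⟩ hpq
      refine hD.deriv.trans_le ?_
      norm_num at hM ⊢
      linarith
  have h := hanti Set.self_mem_Ici (Set.mem_Ici.2 hqr) hqr
  simp only [dlOrdered_self] at h
  rw [zero_rpow (by norm_num)] at h
  linarith

/-- A closed form of `dl`, valid on the unit square and continuous along diagonal translations. -/
noncomputable def dlClosed (p q : ℝ) : ℝ :=
  |q - p| / 2 - |p * (q * log q) - q * (p * log p)| / (p + q)

lemma dlClosed_comm (p q : ℝ) : dlClosed p q = dlClosed q p := by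
  unfold dlClosed
  rw [abs_sub_comm q p, abs_sub_comm (p * _), add_comm p q]

lemma dlClosed_eq_dlOrdered {p q : ℝ} (hp : 0 < p) (hpq : p ≤ q) :
    dlClosed p q = dlOrdered p q := by
  have hq : 0 < q := by linarith
  have hl : 0 ≤ log q - log p := sub_nonneg.2 (log_le_log hp hpq)
  unfold dlClosed dlOrdered
  rw [abs_of_nonneg (sub_nonneg.2 hpq),
    show p * (q * log q) - q * (p * log p) = p * q * (log q - log p) by ring,
    abs_of_nonneg (by positivity)]
  ring

lemma dlClosed_rpow_triangle_of_pos {p q r : ℝ} (hp : 0 < p) (hq : 0 < q) (hr : 0 < r) :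
    dlClosed p r ^ ((1 : ℝ) / 3)
      ≤ dlClosed p q ^ ((1 : ℝ) / 3) + dlClosed q r ^ ((1 : ℝ) / 3) := by
  wlog hpr : p ≤ r generalizing p r
  · have := this hr hp (le_of_not_ge hpr)
    rwa [dlClosed_comm r p, dlClosed_comm r q, dlClosed_comm q p, add_comm] at this
  rw [dlClosed_eq_dlOrdered hp hpr]
  have h0 := dlOrdered_nonneg hp hpr
  rcases le_total q p with hqp | hpq
  · rw [dlClosed_comm p q, dlClosed_eq_dlOrdered hq hqp, dlClosed_eq_dlOrdered hq (hqp.trans hpr)]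
    have := rpow_le_rpow h0
      (dlOrdered_antitoneOn_left hr ⟨hq, hqp.trans hpr⟩ ⟨hp, hpr⟩ hqp) (z := 1 / 3) (by norm_num)
    have := rpow_nonneg (dlOrdered_nonneg hq hqp) (1 / 3)
    linarith
  rcases le_total q r with hqr | hrq
  · rw [dlClosed_eq_dlOrdered hp hpq, dlClosed_eq_dlOrdered hq hqr]
    exact dlOrdered_rpow_triangle hp hpq hqr
  · rw [dlClosed_comm q r, dlClosed_eq_dlOrdered hp hpq, dlClosed_eq_dlOrdered hr hrq]
    have := rpow_le_rpow h0
      ((dlOrdered_strictMonoOn_right hp).monotoneOn hpr hpq hrq) (z := 1 / 3) (by norm_num)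
    have := rpow_nonneg (dlOrdered_nonneg hr hrq) (1 / 3)
    linarith

lemma tendsto_dlClosed_add {p q : ℝ} (hp : 0 ≤ p) (hq : 0 ≤ q) :
    Filter.Tendsto (fun ε => dlClosed (p + ε) (q + ε)) (nhdsWithin 0 (Set.Ioi 0))
      (nhds (dlClosed p q)) := by
  rcases eq_or_ne p q with rfl | hne
  · simp [dlClosed]
  have hpq : p + 0 + (q + 0) ≠ 0 := by
    intro h
    exact hne (by linarith)
  have hc : ContinuousAt (fun ε => dlClosed (p + ε) (q + ε)) 0 := by
    have hlog : ∀ a : ℝ, Continuous fun ε => (a + ε) * log (a + ε) := fun a =>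
      continuous_mul_log.comp (continuous_const.add continuous_id)
    have hnum : Continuous fun ε => |(p + ε) * ((q + ε) * log (q + ε))
        - (q + ε) * ((p + ε) * log (p + ε))| :=
      (((continuous_const.add continuous_id).mul (hlog q)).sub
        ((continuous_const.add continuous_id).mul (hlog p))).abs
    unfold dlClosed
    exact (by fun_prop : ContinuousAt (fun ε => |q + ε - (p + ε)| / 2) 0).sub
      (hnum.continuousAt.div (by fun_prop) hpq)
  have := hc.tendsto.mono_left (nhdsWithin_le_nhds (s := Set.Ioi 0))
  simpa using this

lemma dlClosed_nonneg {p q : ℝ} (hp : 0 ≤ p) (hq : 0 ≤ q) : 0 ≤ dlClosed p q := by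
  refine ge_of_tendsto (tendsto_dlClosed_add hp hq) ?_
  filter_upwards [self_mem_nhdsWithin] with ε hε
  have hε : 0 < ε := hε
  rcases le_total p q with h | h
  · rw [dlClosed_eq_dlOrdered (by linarith) (by linarith)]
    exact dlOrdered_nonneg (by linarith) (by linarith)
  · rw [dlClosed_comm, dlClosed_eq_dlOrdered (by linarith) (by linarith)]
    exact dlOrdered_nonneg (by linarith) (by linarith)

lemma dlClosed_rpow_triangle {p q r : ℝ} (hp : 0 ≤ p) (hq : 0 ≤ q) (hr : 0 ≤ r) :
    dlClosed p r ^ ((1 : ℝ) / 3)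
      ≤ dlClosed p q ^ ((1 : ℝ) / 3) + dlClosed q r ^ ((1 : ℝ) / 3) := by
  have ht : ∀ {a b : ℝ}, 0 ≤ a → 0 ≤ b → Filter.Tendsto
      (fun ε => dlClosed (a + ε) (b + ε) ^ ((1 : ℝ) / 3)) (nhdsWithin 0 (Set.Ioi 0))
      (nhds (dlClosed a b ^ ((1 : ℝ) / 3))) := fun ha hb =>
    (tendsto_dlClosed_add ha hb).rpow_const (Or.inr (by norm_num))
  refine le_of_tendsto_of_tendsto (ht hp hr) ((ht hp hq).add (ht hq hr)) ?_
  filter_upwards [self_mem_nhdsWithin] with ε hε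
  have hε : 0 < ε := hε
  exact dlClosed_rpow_triangle_of_pos (by linarith) (by linarith) (by linarith)

lemma mul_one_sub_log_le {p q : ℝ} (hp : 0 ≤ p) (hpq : p ≤ q) (hq : q ≤ 1) :
    p * (1 - log p) ≤ q * (1 - log q) := by
  rcases hp.eq_or_lt with rfl | hp
  · have : log q ≤ 0 := log_nonpos hpq hq
    simpa using mul_nonneg hpq (by linarith : 0 ≤ 1 - log q)
  have hq0 : 0 < q := by linarith
  have h := log_le_sub_one_of_pos (by positivity : 0 < q / p)
  rw [log_div hq0.ne' hp.ne'] at h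
  have h' := mul_le_mul_of_nonneg_left h hp.le
  rw [show p * (q / p - 1) = q - p by field_simp] at h'
  have := mul_nonneg (sub_nonneg.2 hpq) (neg_nonneg.2 (log_nonpos hq0.le hq))
  linarith

lemma dl_comm (p q : ℝ) : dl p q = dl q p := by
  unfold dl lit deltaH
  rw [abs_sub_comm (p * _), abs_sub_comm (p ^ 2 * _), add_comm p q]

lemma dl_eq_dlClosed {p q : ℝ} (hp : 0 ≤ p) (hp1 : p ≤ 1) (hq : 0 ≤ q) (hq1 : q ≤ 1) :
    dl p q = dlClosed p q := by
  wlog hpq : p ≤ q generalizing p q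
  · rw [dl_comm, dlClosed_comm]
    exact this hq hq1 hp hp1 (le_of_not_ge hpq)
  rcases hq.eq_or_lt with rfl | hq
  · obtain rfl : p = 0 := le_antisymm hpq hp
    simp [dl, lit, deltaH, dlClosed]
  have h1 := mul_one_sub_log_le hp hpq hq1
  have h2 := mul_one_sub_log_le (sq_nonneg p) (pow_le_pow_left₀ hp hpq 2) (pow_le_one₀ hq.le hq1)
  simp only [log_pow, Nat.cast_ofNat] at h2
  have h3 : 0 ≤ p * (q * log q) - q * (p * log p) := by
    rcases hp.eq_or_lt with rfl | hp
    · simp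
    · rw [show p * (q * log q) - q * (p * log p) = p * q * (log q - log p) by ring]
      exact mul_nonneg (by positivity) (sub_nonneg.2 (log_le_log hp hpq))
  unfold dl lit deltaH dlClosed
  rw [abs_of_nonpos (by linarith), abs_of_nonpos (by linarith), abs_of_nonneg (by linarith),
    abs_of_nonneg h3]
  have : p + q ≠ 0 := by positivity
  field_simp
  ring

theorem DL_cuberoot_triangle {ι : Type*} [Fintype ι] (P Q R : ι → ℝ)
    (hP : IsProbDist P) (hQ : IsProbDist Q) (hR : IsProbDist R) :
    DL P R ^ ((1 : ℝ) / 3) ≤ DL P Q ^ ((1 : ℝ) / 3) + DL Q R ^ ((1 : ℝ) / 3) := by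
  have hle : ∀ {S : ι → ℝ}, IsProbDist S → ∀ i, S i ≤ 1 := fun hS i =>
    hS.2 ▸ single_le_sum (fun j _ => hS.1 j) (mem_univ i)
  have hcube : ∀ {a b : ℝ}, 0 ≤ a → 0 ≤ b →
      (dlClosed a b ^ ((1 : ℝ) / 3)) ^ (3 : ℝ) = dlClosed a b := fun ha hb => by
    rw [← rpow_mul (dlClosed_nonneg ha hb)]
    norm_num
  have hDL : ∀ {S T : ι → ℝ}, IsProbDist S → IsProbDist T →
      DL S T = ∑ i, (dlClosed (S i) (T i) ^ ((1 : ℝ) / 3)) ^ (3 : ℝ) := fun hS hT =>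
    sum_congr rfl fun i _ => by
      rw [hcube (hS.1 i) (hT.1 i), dl_eq_dlClosed (hS.1 i) (hle hS i) (hT.1 i) (hle hT i)]
  have hnn : ∀ {S T : ι → ℝ}, IsProbDist S → IsProbDist T → ∀ i,
      0 ≤ dlClosed (S i) (T i) ^ ((1 : ℝ) / 3) := fun hS hT i =>
    rpow_nonneg (dlClosed_nonneg (hS.1 i) (hT.1 i)) _
  rw [hDL hP hR, hDL hP hQ, hDL hQ hR]
  refine le_trans (rpow_le_rpow (sum_nonneg fun i _ => rpow_nonneg (hnn hP hR i) _)
    (sum_le_sum fun i _ => rpow_le_rpow (hnn hP hR i)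
      (dlClosed_rpow_triangle (hP.1 i) (hQ.1 i) (hR.1 i)) (by norm_num)) (by norm_num)) ?_
  exact Lp_add_le_of_nonneg univ (by norm_num) (fun i _ => hnn hP hQ i) fun i _ => hnn hQ hR i
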